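/- arXiv:1905.07038 — 2 statements merged into one kernel-verified Lean document; each statement's English description precedes it below -/
import Mathlib

section
/- Let (K, P) be a stationary random element of H × L. Then for every nonnegative measurable function f on H × L and every n ∈ ℤ, E[f(θ_{P_n}(K, P))/l_0] = E[f(K°, P°)/l_0], where l_0 = P_0 − P_{−1} is the cycle length of the original pair (K, P). -/
open MeasureTheory ProbabilityTheory
open scoped ENNReal

/-- The set `H` of càdlàg real paths indexed by `ℝ` vanishing at `0`. -/
def pathSpace : Set (ℝ → ℝ) :=
  {z | z 0 = 0 ∧ (∀ t : ℝ, ContinuousWithinAt z (Set.Ici t) t) ∧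
      ∀ t : ℝ, ∃ l : ℝ, Filter.Tendsto z (nhdsWithin t (Set.Iio t)) (nhds l)}

/-- The set `L` of strictly increasing two-sided real sequences with `s₋₁ < 0 ≤ s₀`,
tending to `−∞` at `−∞` and to `+∞` at `+∞`. -/
def seqSpace : Set (ℤ → ℝ) :=
  {s | StrictMono s ∧ s (-1) < 0 ∧ 0 ≤ s 0 ∧
      Filter.Tendsto s Filter.atBot Filter.atBot ∧ Filter.Tendsto s Filter.atTop Filter.atTop}

/-- `nIdx s t` is the index `n` with `t ∈ [s (n-1), s n)` (for `s ∈ seqSpace`). -/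
noncomputable def nIdx (s : ℤ → ℝ) (t : ℝ) : ℤ := sInf {n : ℤ | t < s n}

/-- The shift `θ_t` on `H × L`. -/
noncomputable def shift (t : ℝ) (p : (ℝ → ℝ) × (ℤ → ℝ)) : (ℝ → ℝ) × (ℤ → ℝ) :=
  (fun u => p.1 (t + u) - p.1 t, fun k => p.2 (nIdx p.2 t + k) - t)

/-- On `seqSpace`, the index `nIdx s t` is the least `m` with `t < s m`. -/
theorem nIdx_le_iff {s : ℤ → ℝ} (hs : s ∈ seqSpace) (t : ℝ) (m : ℤ) :
    nIdx s t ≤ m ↔ t < s m := by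
  obtain ⟨hmono, -, -, hbot, htop⟩ := hs
  have hne : {n : ℤ | t < s n}.Nonempty := (htop.eventually_gt_atTop t).exists
  have hbdd : BddBelow {n : ℤ | t < s n} := by
    obtain ⟨a, ha⟩ := (hbot.eventually_lt_atBot t).exists
    exact ⟨a, fun n hn => (hmono.lt_iff_lt.1 (ha.trans hn)).le⟩
  exact ⟨fun h => (Int.csInf_mem hne hbdd).trans_le (hmono.monotone h),
    fun h => csInf_le hbdd h⟩

theorem nIdx_apply {s : ℤ → ℝ} (hs : StrictMono s) (n : ℤ) : nIdx s (s n) = n + 1 := by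
  have : {m : ℤ | s n < s m} = Set.Ici (n + 1) := by
    ext m
    simp [hs.lt_iff_lt]
  rw [nIdx, this, csInf_Ici]

/-- A jointly measurable version of the evaluation map, agreeing with it on right-continuous
paths. -/
noncomputable def rightEval (z : ℝ → ℝ) (t : ℝ) : ℝ :=
  Filter.limsup (fun m : ℕ => z ((⌊t * (m + 1)⌋ + 1) / (m + 1))) Filter.atTop

theorem measurable_rightEval : Measurable fun p : (ℝ → ℝ) × ℝ => rightEval p.1 p.2 := by
  refine Measurable.limsup fun m => ?_
  have h : Measurable fun p : (ℝ → ℝ) × ℤ => p.1 (((p.2 : ℝ) + 1) / (m + 1)) :=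
    measurable_from_prod_countable_left fun i =>
      measurable_pi_apply (X := fun _ : ℝ => ℝ) (((i : ℝ) + 1) / (m + 1))
  have h' : Measurable fun p : (ℝ → ℝ) × ℝ => (p.1, ⌊p.2 * ((m : ℝ) + 1)⌋) := by
    fun_prop
  exact h.comp h'

theorem rightEval_eq {z : ℝ → ℝ} {t : ℝ} (hz : ContinuousWithinAt z (Set.Ici t) t) :
    rightEval z t = z t := by
  have hlow (m : ℕ) : t ≤ (⌊t * ((m : ℝ) + 1)⌋ + 1) / ((m : ℝ) + 1) := by
    rw [le_div_iff₀ (by positivity)]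
    exact (Int.lt_floor_add_one _).le
  have hup (m : ℕ) : (⌊t * ((m : ℝ) + 1)⌋ + 1) / ((m : ℝ) + 1) ≤ t + 1 / ((m : ℝ) + 1) := by
    rw [div_le_iff₀ (by positivity), add_mul, one_div_mul_cancel (by positivity)]
    gcongr
    exact Int.floor_le _
  have hlim : Filter.Tendsto (fun m : ℕ => (⌊t * ((m : ℝ) + 1)⌋ + 1) / ((m : ℝ) + 1))
      Filter.atTop (nhds t) := by
    refine tendsto_of_tendsto_of_tendsto_of_le_of_le tendsto_const_nhds ?_ hlow hup
    simpa using tendsto_const_nhds (x := t) |>.add tendsto_one_div_add_atTop_nhds_zero_nat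
  exact (hz.tendsto.comp (tendsto_nhdsWithin_iff.2 ⟨hlim, .of_forall hlow⟩)).limsup_eq

/-- A measurable version of `p ↦ shift (p.2 n) p`. -/
noncomputable def pointShift (n : ℤ) (p : (ℝ → ℝ) × (ℤ → ℝ)) : (ℝ → ℝ) × (ℤ → ℝ) :=
  (fun u => rightEval p.1 (p.2 n + u) - rightEval p.1 (p.2 n),
    fun k => p.2 (n + 1 + k) - p.2 n)

theorem measurable_pointShift (n : ℤ) : Measurable (pointShift n) := by
  have h (u : ℝ) : Measurable fun p : (ℝ → ℝ) × (ℤ → ℝ) => rightEval p.1 (p.2 n + u) :=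
    measurable_rightEval.comp (f := fun p : (ℝ → ℝ) × (ℤ → ℝ) => (p.1, p.2 n + u))
      (by fun_prop)
  refine Measurable.prodMk (measurable_pi_lambda _ fun u => ?_) (by fun_prop)
  exact (h u).sub (by simpa using h 0)

theorem pointShift_eq {p : (ℝ → ℝ) × (ℤ → ℝ)}
    (hz : ∀ t, ContinuousWithinAt p.1 (Set.Ici t) t) (hs : StrictMono p.2) (n : ℤ) :
    pointShift n p = shift (p.2 n) p := by
  simp [pointShift, shift, nIdx_apply hs, rightEval_eq (hz _)]

/-- Shifting to a point of the sequence is unaffected by a preliminary shift. -/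
theorem pointShift_shift {p : (ℝ → ℝ) × (ℤ → ℝ)}
    (hz : ∀ t, ContinuousWithinAt p.1 (Set.Ici t) t) (n : ℤ) (t : ℝ) :
    pointShift n (shift t p) = pointShift (nIdx p.2 t + n) p := by
  have hz' (v : ℝ) : ContinuousWithinAt (shift t p).1 (Set.Ici v) v := by
    refine ContinuousWithinAt.sub ?_ continuousWithinAt_const
    refine (hz (t + v)).comp (f := fun u => t + u) (by fun_prop) fun u hu => ?_
    simpa using hu
  ext x
  · simp only [pointShift, rightEval_eq (hz' _), rightEval_eq (hz _)]
    simp only [shift]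
    ring_nf
  · simp only [pointShift, shift]
    ring_nf

/-- The mass sent from time `0` to time `t`: the weight `f (pointShift n p)` is spread uniformly
over the `n`-th cycle and normalised by the length of the cycle straddling `0`. -/
noncomputable def cycleTransport (f : (ℝ → ℝ) × (ℤ → ℝ) → ℝ≥0∞) (n : ℤ)
    (p : (ℝ → ℝ) × (ℤ → ℝ)) (t : ℝ) : ℝ≥0∞ :=
  (Set.Ico (p.2 (n - 1)) (p.2 n)).indicator (fun _ => f (pointShift n p) *
    (ENNReal.ofReal (p.2 0 - p.2 (-1)))⁻¹ * (ENNReal.ofReal (p.2 n - p.2 (n - 1)))⁻¹) t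

theorem measurable_cycleTransport {f : (ℝ → ℝ) × (ℤ → ℝ) → ℝ≥0∞} (hf : Measurable f) (n : ℤ) :
    Measurable (Function.uncurry (cycleTransport f n)) := by
  have hp (k : ℤ) : Measurable fun q : ((ℝ → ℝ) × (ℤ → ℝ)) × ℝ => q.1.2 k := by fun_prop
  have hS : MeasurableSet {q : ((ℝ → ℝ) × (ℤ → ℝ)) × ℝ | q.1.2 (n - 1) ≤ q.2 ∧ q.2 < q.1.2 n} :=
    (measurableSet_le (hp (n - 1)) measurable_snd).inter
      (measurableSet_lt measurable_snd (hp n))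
  have hfS := hf.comp (measurable_pointShift n)
  have hc : Measurable fun q : ((ℝ → ℝ) × (ℤ → ℝ)) × ℝ => f (pointShift n q.1) *
      (ENNReal.ofReal (q.1.2 0 - q.1.2 (-1)))⁻¹ *
      (ENNReal.ofReal (q.1.2 n - q.1.2 (n - 1)))⁻¹ :=
    ((hfS.comp measurable_fst).mul (by fun_prop)).mul (by fun_prop)
  exact hc.indicator hS

theorem lintegral_cycleTransport (f : (ℝ → ℝ) × (ℤ → ℝ) → ℝ≥0∞) (n : ℤ)
    {p : (ℝ → ℝ) × (ℤ → ℝ)} (hs : StrictMono p.2) :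
    ∫⁻ t, cycleTransport f n p t
      = f (pointShift n p) / ENNReal.ofReal (p.2 0 - p.2 (-1)) := by
  have h : 0 < p.2 n - p.2 (n - 1) := sub_pos.2 (hs (sub_one_lt n))
  simp only [cycleTransport]
  rw [lintegral_indicator_const measurableSet_Ico, Real.volume_Ico, mul_assoc,
    ENNReal.inv_mul_cancel (by simpa using h) ENNReal.ofReal_ne_top, mul_one, div_eq_mul_inv]

/-- The mass received at time `0` from time `-t`, by the cycle containing `0`, comes from the
cycle of index `-n`. -/
theorem cycleTransport_shift_neg (f : (ℝ → ℝ) × (ℤ → ℝ) → ℝ≥0∞) (n : ℤ)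
    {p : (ℝ → ℝ) × (ℤ → ℝ)} (hz : ∀ t, ContinuousWithinAt p.1 (Set.Ici t) t)
    (hs : p.2 ∈ seqSpace) (h0 : 0 < p.2 0) (t : ℝ) :
    cycleTransport f n (shift (-t) p) t
      = (Set.Ico (p.2 (-n - 1)) (p.2 (-n))).indicator (fun _ => f (pointShift 0 p) *
          (ENNReal.ofReal (p.2 0 - p.2 (-1)))⁻¹ *
          (ENNReal.ofReal (p.2 (-n) - p.2 (-n - 1)))⁻¹) (-t) := by
  have hiff := nIdx_le_iff hs (-t)
  have h1 : p.2 (-1) < 0 := hs.2.1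
  have hmono : StrictMono p.2 := hs.1
  simp only [cycleTransport, pointShift_shift hz]
  simp only [shift]
  generalize nIdx p.2 (-t) = j at hiff
  have hmem : t ∈ Set.Ico (p.2 (j + (n - 1)) - -t) (p.2 (j + n) - -t) ↔ j = -n := by
    constructor
    · rintro ⟨ha, hb⟩
      have ha' : j + (n - 1) < 0 := hmono.lt_iff_lt.1 (by linarith)
      have hb' : -1 < j + n := hmono.lt_iff_lt.1 (by linarith)
      omega
    · rintro rfl
      simp only [neg_add_cancel, Set.mem_Ico, show -n + (n - 1) = -1 by ring]
      constructor <;> linarith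
  have hmem' : -t ∈ Set.Ico (p.2 (-n - 1)) (p.2 (-n)) ↔ j = -n := by
    rw [Set.mem_Ico, ← hiff, ← not_lt, ← hiff]
    omega
  by_cases hj : j = -n
  · rw [Set.indicator_of_mem (hmem.2 hj), Set.indicator_of_mem (hmem'.2 hj), hj, mul_right_comm]
    simp only [neg_add_cancel, show -n + (n - 1) = -1 by ring, add_zero, sub_sub_sub_cancel_right,
      ← sub_eq_add_neg]
  · rw [Set.indicator_of_notMem (mt hmem.1 hj), Set.indicator_of_notMem (mt hmem'.1 hj)]

theorem lintegral_cycleTransport_shift_neg (f : (ℝ → ℝ) × (ℤ → ℝ) → ℝ≥0∞) (n : ℤ)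
    {p : (ℝ → ℝ) × (ℤ → ℝ)} (hz : ∀ t, ContinuousWithinAt p.1 (Set.Ici t) t)
    (hs : p.2 ∈ seqSpace) (h0 : 0 < p.2 0) :
    ∫⁻ t, cycleTransport f n (shift (-t) p) t
      = f (pointShift 0 p) / ENNReal.ofReal (p.2 0 - p.2 (-1)) := by
  have h : 0 < p.2 (-n) - p.2 (-n - 1) := sub_pos.2 (hs.1 (sub_one_lt (-n)))
  simp only [cycleTransport_shift_neg f n hz hs h0]
  rw [lintegral_neg_eq_self, lintegral_indicator_const measurableSet_Ico, Real.volume_Ico,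
    mul_assoc, ENNReal.inv_mul_cancel (by simpa using h) ENNReal.ofReal_ne_top, mul_one,
    div_eq_mul_inv]

/-- Cycle stationarity: for a stationary random element `(K, P)` of `H × L`, for every
nonnegative measurable `f` and every `n ∈ ℤ`,
`E[f(θ_{P_n}(K, P))/l₀] = E[f(K°, P°)/l₀]`, where `(K°, P°) = θ_{P₀}(K, P)` and
`l₀ = P₀ − P₋₁`. -/
theorem cycle_stationarity
    {Ω : Type*} [MeasurableSpace Ω] (μ : Measure Ω) [IsProbabilityMeasure μ]
    (K : Ω → ℝ → ℝ) (P : Ω → ℤ → ℝ)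
    (hmem : ∀ ω, K ω ∈ pathSpace ∧ P ω ∈ seqSpace)
    (hmeas : Measurable fun ω => (K ω, P ω))
    (hstat : ∀ s : ℝ,
      Measure.map (fun ω => shift s (K ω, P ω)) μ = Measure.map (fun ω => (K ω, P ω)) μ)
    (f : (ℝ → ℝ) × (ℤ → ℝ) → ℝ≥0∞) (hf : Measurable f) (n : ℤ) :
    ∫⁻ ω, f (shift (P ω n) (K ω, P ω)) / ENNReal.ofReal (P ω 0 - P ω (-1)) ∂μ
      = ∫⁻ ω, f (shift (P ω 0) (K ω, P ω)) / ENNReal.ofReal (P ω 0 - P ω (-1)) ∂μ := by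
  set X : Ω → (ℝ → ℝ) × (ℤ → ℝ) := fun ω => (K ω, P ω) with hX
  have hz (ω : Ω) (t : ℝ) : ContinuousWithinAt (X ω).1 (Set.Ici t) t := (hmem ω).1.2.1 t
  have hs (ω : Ω) : (X ω).2 ∈ seqSpace := (hmem ω).2
  have hprob : IsProbabilityMeasure (μ.map X) := Measure.isProbabilityMeasure_map hmeas.aemeasurable
  have hshift (s : ℝ) : AEMeasurable (fun ω => shift s (X ω)) μ :=
    AEMeasurable.of_map_ne_zero (by rw [hstat s]; exact hprob.ne_zero)
  have hpos : ∀ᵐ ω ∂μ, 0 < (X ω).2 0 := by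
    have hS : MeasurableSet {p : (ℝ → ℝ) × (ℤ → ℝ) | 0 < p.2 0} :=
      measurableSet_lt (by fun_prop) (by fun_prop)
    rw [← ae_map_iff (p := fun p => 0 < p.2 0) hmeas.aemeasurable hS, ← hstat 0,
      ae_map_iff (hshift 0) hS]
    refine .of_forall fun ω => ?_
    simpa [shift] using (nIdx_le_iff (hs ω) 0 _).1 le_rfl
  have hT := measurable_cycleTransport hf n
  have hTX : Measurable (Function.uncurry fun ω t => cycleTransport f n (X ω) t) :=
    hT.comp (hmeas.prodMap measurable_id)
  have hstep (t : ℝ) : ∫⁻ ω, cycleTransport f n (X ω) t ∂μ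
      = ∫⁻ ω, cycleTransport f n (shift (-t) (X ω)) t ∂μ := by
    have ht : Measurable fun p => cycleTransport f n p t := hT.of_uncurry_right
    rw [← lintegral_map ht hmeas, ← hstat (-t), lintegral_map' ht.aemeasurable (hshift (-t))]
  have hshiftT : AEMeasurable
      (Function.uncurry fun t ω => cycleTransport f n (shift (-t) (X ω)) t) (volume.prod μ) := by
    have hP (k : ℤ) : Measurable fun ω => P ω k := (measurable_pi_apply k).comp hmeas.snd
    have hS : MeasurableSet {q : ℝ × Ω | P q.2 (-n - 1) ≤ -q.1 ∧ -q.1 < P q.2 (-n)} :=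
      (measurableSet_le ((hP _).comp measurable_snd) measurable_fst.neg).inter
        (measurableSet_lt measurable_fst.neg ((hP _).comp measurable_snd))
    have hc : Measurable fun ω => f (pointShift 0 (X ω)) *
        (ENNReal.ofReal (P ω 0 - P ω (-1)))⁻¹ *
        (ENNReal.ofReal (P ω (-n) - P ω (-n - 1)))⁻¹ :=
      ((hf.comp ((measurable_pointShift 0).comp hmeas)).mul
        ((hP _).sub (hP _)).ennreal_ofReal.inv).mul ((hP _).sub (hP _)).ennreal_ofReal.inv
    refine ⟨_, (hc.comp measurable_snd).indicator hS, ?_⟩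
    filter_upwards [Measure.quasiMeasurePreserving_snd.ae hpos] with q h0
    exact cycleTransport_shift_neg f n (hz q.2) (hs q.2) h0 q.1
  calc
    _ = ∫⁻ ω, ∫⁻ t : ℝ, cycleTransport f n (X ω) t ∂volume ∂μ := lintegral_congr fun ω => by
      rw [lintegral_cycleTransport f n (hs ω).1, pointShift_eq (hz ω) (hs ω).1]
    _ = ∫⁻ t : ℝ, ∫⁻ ω, cycleTransport f n (X ω) t ∂μ ∂volume :=
      lintegral_lintegral_swap hTX.aemeasurable
    _ = ∫⁻ t : ℝ, ∫⁻ ω, cycleTransport f n (shift (-t) (X ω)) t ∂μ ∂volume :=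
      lintegral_congr hstep
    _ = ∫⁻ ω, ∫⁻ t : ℝ, cycleTransport f n (shift (-t) (X ω)) t ∂volume ∂μ :=
      lintegral_lintegral_swap hshiftT
    _ = _ := lintegral_congr_ae <| hpos.mono fun ω h0 => by
      beta_reduce
      rw [lintegral_cycleTransport_shift_neg f n (hz ω) (hs ω) h0, pointShift_eq (hz ω) (hs ω).1]
end

section
/- Let α > 0, β ∈ ℝ with |β| < α, and λ ≥ 0. Then ∫_0^∞ e^{−λ l} · (4α e^{−(α−β)² l/2}/√(2π l) − 4α(3α+β) e^{4α(α+β) l} Φ̄((3α+β)√l)) dl = 4α / (3α + β + √(2λ + (α−β)²)), where Φ̄(x) = ∫_x^∞ e^{−u²/2}/√(2π) du. -/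
open Real

/-- The standard Gaussian upper tail `Φ̄(x) = ∫_x^∞ e^{−u²/2}/√(2π) du`. -/
noncomputable def gaussTail (x : ℝ) : ℝ :=
  ∫ u in Set.Ioi x, Real.exp (-u ^ 2 / 2) / Real.sqrt (2 * π)

open MeasureTheory Filter Topology Set

lemma continuous_gaussDensity :
    Continuous fun u : ℝ => Real.exp (-u ^ 2 / 2) / Real.sqrt (2 * π) := by
  fun_prop

lemma integrable_gaussDensity :
    Integrable fun u : ℝ => Real.exp (-u ^ 2 / 2) / Real.sqrt (2 * π) := by
  have h := (integrable_exp_neg_mul_sq (b := 1 / 2) (by norm_num)).div_const (Real.sqrt (2 * π))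
  refine h.congr (Eventually.of_forall fun u => ?_)
  simp only
  congr 2
  ring

lemma gaussTail_nonneg (x : ℝ) : 0 ≤ gaussTail x :=
  setIntegral_nonneg measurableSet_Ioi fun _ _ => by positivity

lemma gaussTail_zero : gaussTail 0 = 1 / 2 := by
  have h := integral_gaussian_Ioi (1 / 2)
  have hInt : gaussTail 0 = (∫ u in Ioi (0:ℝ), Real.exp (-(1 / 2) * u ^ 2)) / Real.sqrt (2 * π) := by
    rw [gaussTail, integral_div]
    congr 2
    funext u
    congr 1
    ring
  have hpi : π / (1 / 2) = 2 * π := by ring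
  rw [hInt, h, hpi]
  have : Real.sqrt (2 * π) ≠ 0 := by positivity
  field_simp

lemma hasDerivAt_gaussTail (x : ℝ) :
    HasDerivAt gaussTail (-(Real.exp (-x ^ 2 / 2) / Real.sqrt (2 * π))) x := by
  have h : gaussTail = fun y => gaussTail 0 -
      ∫ u in (0:ℝ)..y, Real.exp (-u ^ 2 / 2) / Real.sqrt (2 * π) := by
    funext y
    have := intervalIntegral.integral_Ioi_sub_Ioi'
      (integrable_gaussDensity.integrableOn (s := Ioi 0))
      (integrable_gaussDensity.integrableOn (s := Ioi y))
    simp only [gaussTail]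
    linarith
  rw [h]
  exact (continuous_gaussDensity.integral_hasStrictDerivAt 0 x).hasDerivAt.const_sub _

lemma continuous_gaussTail : Continuous gaussTail :=
  continuous_iff_continuousAt.2 fun x => (hasDerivAt_gaussTail x).continuousAt

/-- Mills' inequality. -/
lemma mul_gaussTail_le {x : ℝ} (hx : 0 ≤ x) :
    x * gaussTail x ≤ Real.exp (-x ^ 2 / 2) / Real.sqrt (2 * π) := by
  have hderiv : ∀ u ∈ Ioi x, HasDerivAt
      (fun u : ℝ => -(Real.exp (-u ^ 2 / 2) / Real.sqrt (2 * π)))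
      (u * (Real.exp (-u ^ 2 / 2) / Real.sqrt (2 * π))) u := fun u _ => by
    have h := (((((hasDerivAt_id u).pow 2).neg.div_const 2).exp).div_const
      (Real.sqrt (2 * π))).neg
    refine h.congr_deriv ?_
    simp
    ring
  have hcont : ContinuousWithinAt
      (fun u : ℝ => -(Real.exp (-u ^ 2 / 2) / Real.sqrt (2 * π))) (Ici x) x :=
    continuous_gaussDensity.neg.continuousWithinAt
  have hpos : ∀ u ∈ Ioi x, 0 ≤ u * (Real.exp (-u ^ 2 / 2) / Real.sqrt (2 * π)) :=
    fun u hu => mul_nonneg (hx.trans (le_of_lt hu)) (by positivity)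
  have hlim : Tendsto (fun u : ℝ => -(Real.exp (-u ^ 2 / 2) / Real.sqrt (2 * π)))
      atTop (𝓝 0) := by
    have hsq : Tendsto (fun u : ℝ => -u ^ 2 / 2) atTop atBot := by
      have := (tendsto_pow_atTop (α := ℝ) two_ne_zero).atTop_div_const (two_pos)
      refine (tendsto_neg_atTop_atBot.comp this).congr fun u => ?_
      simp only [Function.comp]
      ring
    simpa using ((Real.tendsto_exp_atBot.comp hsq).div_const (Real.sqrt (2 * π))).neg
  have hval := integral_Ioi_of_hasDerivAt_of_nonneg hcont hderiv hpos hlim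
  have hInt := integrableOn_Ioi_deriv_of_nonneg hcont hderiv hpos hlim
  calc x * gaussTail x
      = ∫ u in Ioi x, x * (Real.exp (-u ^ 2 / 2) / Real.sqrt (2 * π)) := by
        rw [gaussTail, integral_const_mul]
    _ ≤ ∫ u in Ioi x, u * (Real.exp (-u ^ 2 / 2) / Real.sqrt (2 * π)) :=
        setIntegral_mono_on (integrable_gaussDensity.integrableOn.const_mul x) hInt
          measurableSet_Ioi fun u hu => mul_le_mul_of_nonneg_right (le_of_lt hu) (by positivity)
    _ = _ := by rw [hval]; ring

lemma hasDerivAt_gaussTail_mul_sqrt (a : ℝ) {l : ℝ} (hl : 0 < l) :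
    HasDerivAt (fun l => gaussTail (a * Real.sqrt l))
      (-(a / 2 * (Real.exp (-(a ^ 2 * l) / 2) / Real.sqrt (2 * π * l)))) l := by
  have h := (hasDerivAt_gaussTail (a * Real.sqrt l)).comp l
    ((Real.hasDerivAt_sqrt hl.ne').const_mul a)
  refine h.congr_deriv ?_
  rw [mul_pow, Real.sq_sqrt hl.le, Real.sqrt_mul (by positivity : (0:ℝ) ≤ 2 * π)]
  have h1 : Real.sqrt (2 * π) ≠ 0 := by positivity
  have h2 : Real.sqrt l ≠ 0 := by positivity
  field_simp

lemma mul_exp_mul_gaussTail_le {a l : ℝ} (p : ℝ) (ha : 0 < a) (hl : 0 < l) :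
    a * (Real.exp ((a ^ 2 - p) / 2 * l) * gaussTail (a * Real.sqrt l)) ≤
      Real.exp (-(p * l) / 2) / Real.sqrt (2 * π * l) := by
  have h := mul_gaussTail_le (x := a * Real.sqrt l) (by positivity)
  rw [mul_pow, Real.sq_sqrt hl.le] at h
  have hexp : Real.exp (-(p * l) / 2) =
      Real.exp ((a ^ 2 - p) / 2 * l) * Real.exp (-(a ^ 2 * l) / 2) := by
    rw [← Real.exp_add]
    congr 1
    ring
  rw [Real.sqrt_mul (by positivity : (0:ℝ) ≤ 2 * π), hexp, ← div_div, le_div_iff₀ (by positivity)]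
  calc _ = Real.exp ((a ^ 2 - p) / 2 * l) * (a * Real.sqrt l * gaussTail (a * Real.sqrt l)) := by
        ring
    _ ≤ _ := by
        rw [mul_div_assoc]
        exact mul_le_mul_of_nonneg_left h (Real.exp_nonneg _)

lemma tendsto_pow_mul_exp_neg_div_sqrt (n : ℕ) {p : ℝ} (hp : 0 < p) :
    Tendsto (fun l : ℝ => l ^ n * (Real.exp (-(p * l) / 2) / Real.sqrt (2 * π * l)))
      atTop (𝓝 0) := by
  have h := (tendsto_rpow_mul_exp_neg_mul_atTop_nhds_zero ((n : ℝ) - 1 / 2) (p / 2)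
    (by positivity)).div_const (Real.sqrt (2 * π))
  rw [zero_div] at h
  refine h.congr' ?_
  filter_upwards [eventually_gt_atTop 0] with l hl
  rw [Real.rpow_sub hl, Real.rpow_natCast, ← Real.sqrt_eq_rpow,
    Real.sqrt_mul (by positivity : (0:ℝ) ≤ 2 * π),
    show -(p / 2) * l = -(p * l) / 2 by ring]
  have h1 : Real.sqrt (2 * π) ≠ 0 := by positivity
  have h2 : Real.sqrt l ≠ 0 := by positivity
  field_simp

lemma tendsto_pow_mul_exp_mul_gaussTail (n : ℕ) {a p : ℝ} (ha : 0 < a) (hp : 0 < p) :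
    Tendsto (fun l : ℝ => l ^ n * (Real.exp ((a ^ 2 - p) / 2 * l) * gaussTail (a * Real.sqrt l)))
      atTop (𝓝 0) := by
  have h := (tendsto_pow_mul_exp_neg_div_sqrt n hp).div_const a
  rw [zero_div] at h
  refine squeeze_zero' ?_ ?_ h
  · filter_upwards [eventually_gt_atTop 0] with l hl
    have := gaussTail_nonneg (a * Real.sqrt l)
    positivity
  · filter_upwards [eventually_gt_atTop 0] with l hl
    rw [mul_div_assoc]
    refine mul_le_mul_of_nonneg_left ?_ (by positivity)
    rw [le_div_iff₀ ha, mul_comm]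
    exact mul_exp_mul_gaussTail_le p ha hl

lemma tendsto_gaussTail_mul_sqrt {s : ℝ} (hs : 0 < s) :
    Tendsto (fun l : ℝ => gaussTail (s * Real.sqrt l)) atTop (𝓝 0) := by
  simpa using tendsto_pow_mul_exp_mul_gaussTail 0 hs (pow_pos hs 2)

lemma hasDerivAt_exp_const_mul (k l : ℝ) :
    HasDerivAt (fun l => Real.exp (k * l)) (k * Real.exp (k * l)) l := by
  simpa [mul_comm] using ((hasDerivAt_id l).const_mul k).exp

lemma integral_exp_div_sqrt_sub_gaussTail {a s : ℝ} (ha : 0 < a) (hs : 0 < s) :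
    ∫ l in Ioi (0:ℝ), (Real.exp (-(s ^ 2 * l) / 2) / Real.sqrt (2 * π * l) -
      a * (Real.exp ((a ^ 2 - s ^ 2) / 2 * l) * gaussTail (a * Real.sqrt l))) = 1 / (a + s) := by
  have hpos : ∀ l ∈ Ioi (0:ℝ), 0 ≤ Real.exp (-(s ^ 2 * l) / 2) / Real.sqrt (2 * π * l) -
      a * (Real.exp ((a ^ 2 - s ^ 2) / 2 * l) * gaussTail (a * Real.sqrt l)) :=
    fun l hl => sub_nonneg.2 (mul_exp_mul_gaussTail_le _ ha hl)
  have hcont := continuous_gaussTail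
  rcases eq_or_ne a s with rfl | hne
  · set F : ℝ → ℝ := fun l => Real.sqrt l * Real.exp (-(a ^ 2) / 2 * l) / Real.sqrt (2 * π) -
      (1 / a + a * l) * gaussTail (a * Real.sqrt l) with hF
    have hderiv : ∀ l ∈ Ioi (0:ℝ), HasDerivAt F
        (Real.exp (-(a ^ 2 * l) / 2) / Real.sqrt (2 * π * l) -
          a * (Real.exp ((a ^ 2 - a ^ 2) / 2 * l) * gaussTail (a * Real.sqrt l))) l := by
      intro l hl
      have hl : 0 < l := hl
      have h := (((Real.hasDerivAt_sqrt hl.ne').mul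
        (hasDerivAt_exp_const_mul (-(a ^ 2) / 2) l)).div_const (Real.sqrt (2 * π))).sub
        ((((hasDerivAt_id l).const_mul a).const_add (1 / a)).mul
          (hasDerivAt_gaussTail_mul_sqrt a hl))
      refine h.congr_deriv ?_
      rw [Real.sqrt_mul (by positivity : (0:ℝ) ≤ 2 * π),
        show -(a ^ 2) / 2 * l = -(a ^ 2 * l) / 2 by ring]
      have h1 : Real.sqrt (2 * π) ≠ 0 := by positivity
      have h2 : Real.sqrt l ≠ 0 := by positivity
      have h3 : Real.sqrt l ^ 2 = l := Real.sq_sqrt hl.le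
      simp only [sub_self, zero_div, zero_mul, Real.exp_zero, id]
      generalize Real.exp (-(a ^ 2 * l) / 2) = E
      generalize gaussTail (a * Real.sqrt l) = G
      rw [← h3, Real.sqrt_sq (Real.sqrt_nonneg l)]
      field_simp
      ring
    have hlim : Tendsto F atTop (𝓝 0) := by
      have h := ((tendsto_pow_mul_exp_neg_div_sqrt 1 (pow_pos ha 2)).sub
        ((tendsto_gaussTail_mul_sqrt ha).const_mul (1 / a))).sub
        ((tendsto_pow_mul_exp_mul_gaussTail 1 ha (pow_pos ha 2)).const_mul a)
      simp only [mul_zero, sub_zero] at h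
      refine h.congr' ?_
      filter_upwards [eventually_gt_atTop 0] with l hl
      rw [hF, Real.sqrt_mul (by positivity : (0:ℝ) ≤ 2 * π)]
      simp only [sub_self, zero_div, zero_mul, Real.exp_zero]
      rw [show -(a ^ 2) / 2 * l = -(a ^ 2 * l) / 2 by ring]
      have h1 : Real.sqrt (2 * π) ≠ 0 := by positivity
      have h2 : Real.sqrt l ≠ 0 := by positivity
      have h3 : Real.sqrt l ^ 2 = l := Real.sq_sqrt hl.le
      generalize Real.exp (-(a ^ 2 * l) / 2) = E
      generalize gaussTail (a * Real.sqrt l) = G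
      rw [← h3, Real.sqrt_sq (Real.sqrt_nonneg l)]
      field_simp
      ring
    have hc : ContinuousWithinAt F (Ici 0) 0 := by
      apply Continuous.continuousWithinAt
      fun_prop
    rw [integral_Ioi_of_hasDerivAt_of_nonneg hc hderiv hpos hlim, hF]
    simp [gaussTail_zero]
    field_simp
    ring
  · have hk : a ^ 2 - s ^ 2 ≠ 0 := fun h => hne <| by nlinarith
    set k := (a ^ 2 - s ^ 2) / 2 with hkdef
    have hk0 : k ≠ 0 := div_ne_zero hk two_ne_zero
    set F : ℝ → ℝ := fun l => (a ^ 2 / k - 2) / s * gaussTail (s * Real.sqrt l) -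
      a / k * (Real.exp (k * l) * gaussTail (a * Real.sqrt l)) with hF
    have hderiv : ∀ l ∈ Ioi (0:ℝ), HasDerivAt F
        (Real.exp (-(s ^ 2 * l) / 2) / Real.sqrt (2 * π * l) -
          a * (Real.exp (k * l) * gaussTail (a * Real.sqrt l))) l := by
      intro l hl
      have hl : 0 < l := hl
      have h := ((hasDerivAt_gaussTail_mul_sqrt s hl).const_mul ((a ^ 2 / k - 2) / s)).sub
        (((hasDerivAt_exp_const_mul k l).mul
          (hasDerivAt_gaussTail_mul_sqrt a hl)).const_mul (a / k))
      refine h.congr_deriv ?_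
      have hexp : Real.exp (-(s ^ 2 * l) / 2) =
          Real.exp (k * l) * Real.exp (-(a ^ 2 * l) / 2) := by
        rw [← Real.exp_add, hkdef]
        congr 1
        ring
      rw [hexp]
      have h1 : Real.sqrt (2 * π * l) ≠ 0 := by positivity
      field_simp
      ring
    have hlim : Tendsto F atTop (𝓝 0) := by
      have h := ((tendsto_gaussTail_mul_sqrt hs).const_mul ((a ^ 2 / k - 2) / s)).sub
        ((tendsto_pow_mul_exp_mul_gaussTail 0 ha (pow_pos hs 2)).const_mul (a / k))
      simpa only [pow_zero, one_mul, mul_zero, sub_zero] using h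
    have hc : ContinuousWithinAt F (Ici 0) 0 := by
      apply Continuous.continuousWithinAt
      fun_prop
    rw [integral_Ioi_of_hasDerivAt_of_nonneg hc hderiv hpos hlim, hF]
    simp only [Real.sqrt_zero, mul_zero, gaussTail_zero, Real.exp_zero]
    rw [hkdef]
    have : a + s ≠ 0 := by positivity
    field_simp
    ring

/-- Laplace transform of the density of the time `L` to the peak of the minorant during
a generic excursion of Brownian motion with drift `β`, `|β| < α`:
`∫₀^∞ e^{−λl} (4α e^{−(α−β)² l/2}/√(2πl) − 4α(3α+β) e^{4α(α+β)l} Φ̄((3α+β)√l)) dl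
  = 4α/(3α + β + √(2λ + (α−β)²))`. -/
theorem peak_time_density_laplace (α β lam : ℝ) (hα : 0 < α) (hβ : |β| < α)
    (hlam : 0 ≤ lam) :
    ∫ l in Set.Ioi (0:ℝ), Real.exp (-lam * l) *
        (4 * α * Real.exp (-(α - β) ^ 2 * l / 2) / Real.sqrt (2 * π * l)
          - 4 * α * (3 * α + β) * Real.exp (4 * α * (α + β) * l) *
              gaussTail ((3 * α + β) * Real.sqrt l))
      = 4 * α / (3 * α + β + Real.sqrt (2 * lam + (α - β) ^ 2)) := by
  have hαβ := abs_lt.1 hβ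
  have ha : 0 < 3 * α + β := by linarith
  have hp : 0 < 2 * lam + (α - β) ^ 2 := by
    have : 0 < (α - β) ^ 2 := pow_pos (by linarith) 2
    linarith
  have hs := Real.sqrt_pos.2 hp
  have h := integral_exp_div_sqrt_sub_gaussTail ha hs
  rw [Real.sq_sqrt hp.le] at h
  rw [div_eq_mul_one_div, ← h, ← integral_const_mul]
  congr 1
  funext l
  have h1 : Real.exp (-((2 * lam + (α - β) ^ 2) * l) / 2) =
      Real.exp (-lam * l) * Real.exp (-(α - β) ^ 2 * l / 2) := by
    rw [← Real.exp_add]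
    congr 1
    ring
  have h2 : Real.exp (((3 * α + β) ^ 2 - (2 * lam + (α - β) ^ 2)) / 2 * l) =
      Real.exp (-lam * l) * Real.exp (4 * α * (α + β) * l) := by
    rw [← Real.exp_add]
    congr 1
    ring
  rw [h1, h2]
  ring
end
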